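/- arXiv:1306.3045 — 3 statements merged into one kernel-verified Lean document; each statement's English description precedes it below -/
import Mathlib

section
/- Let G be a finite cyclic group with generator δ acting on a finitely generated free ℤ-module Q with Q^G = 0. Then H¹(G, Q) is a finite group of order |χ(1)|, where χ(t) is the characteristic polynomial of the action of δ on Q. -/
open groupCohomology
open scoped CategoryTheory

/-- The index of the image of an injective endomorphism is the absolute determinant. -/
theorem card_quot_range_eq (Q : Type) [AddCommGroup Q] [Module.Free ℤ Q]
    [Module.Finite ℤ Q] (f : Q →ₗ[ℤ] Q) (hf : Function.Injective f) :
    Nat.card (Q ⧸ LinearMap.range f) = (LinearMap.det f).natAbs := by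
  rw [← Submodule.natAbs_det_equiv (LinearMap.range f) (LinearEquiv.ofInjective f hf)]
  congr 2

theorem det_ne_zero_of_inj (Q : Type) [AddCommGroup Q] [Module.Free ℤ Q]
    [Module.Finite ℤ Q] (f : Q →ₗ[ℤ] Q) (hf : Function.Injective f) :
    LinearMap.det f ≠ 0 := by
  rw [Ne, LinearMap.det_eq_zero_iff_ker_ne_bot, not_not]
  exact LinearMap.ker_eq_bot.2 hf

theorem h1_aux (G : Type) [CommGroup G] [Fintype G]
    (δ : G) (hgen : ∀ g : G, g ∈ Subgroup.zpowers δ)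
    (Q : Type) [AddCommGroup Q] [Module.Free ℤ Q] [Module.Finite ℤ Q]
    (ρ : Representation ℤ G Q) (hinv : ρ.invariants = ⊥) :
    Finite (H1 (Rep.of ρ)) ∧
      Nat.card (H1 (Rep.of ρ)) = ((ρ δ).charpoly.eval 1).natAbs := by
  have hinj : Function.Injective (1 - ρ δ : Q →ₗ[ℤ] Q) := by
    rw [← LinearMap.ker_eq_bot, eq_bot_iff, ← hinv]
    intro x hx
    rw [Representation.mem_invariants_iff_of_forall_mem_zpowers ρ δ hgen]
    have hx' : x - ρ δ x = 0 := hx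
    exact (sub_eq_zero.1 hx').symm
  have hnorm : ∀ x, ρ.norm x = 0 := by
    intro x
    have : ρ.norm x ∈ ρ.invariants := fun g => by simp
    simpa [hinv] using this
  have hdet : (ρ δ).charpoly.eval 1 = LinearMap.det (1 - ρ δ : Q →ₗ[ℤ] Q) := by
    rw [LinearMap.eval_charpoly]; simp
  let π := (Rep.FiniteCyclicGroup.groupCohomologyπOdd (Rep.of ρ) δ hgen 1 odd_one)
  have hepi : CategoryTheory.Epi π :=
    CategoryTheory.epi_comp' (@CategoryTheory.IsIso.epi_of_iso _ _ _ _ _ (CategoryTheory.Iso.isIso_inv _))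
      (CategoryTheory.epi_comp' inferInstance (CategoryTheory.IsIso.epi_of_iso (CategoryTheory.Iso.inv _)))
  have hπ : Function.Surjective π := (ModuleCat.epi_iff_surjective _).1 inferInstance
  let ι : Q →ₗ[ℤ] LinearMap.ker (Rep.of ρ).norm.hom.toLinearMap :=
    LinearMap.codRestrict _ LinearMap.id (fun x => hnorm x)
  let φ : Q →ₗ[ℤ] H1 (Rep.of ρ) := π.hom ∘ₗ ι
  have hφ : Function.Surjective φ := by
    intro y
    obtain ⟨x, rfl⟩ := hπ y
    exact ⟨x.1, rfl⟩
  have hker : LinearMap.ker φ = LinearMap.range (1 - ρ δ : Q →ₗ[ℤ] Q) := by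
    ext x
    have := Rep.FiniteCyclicGroup.groupCohomologyπOdd_eq_zero_iff (Rep.of ρ) δ hgen 1 odd_one (ι x)
    refine Iff.trans this ?_
    constructor
    · rintro ⟨y, hy⟩
      refine ⟨-y, ?_⟩
      have hy' : ρ δ y - y = x := hy
      rw [← hy']
      change -y - ρ δ (-y) = ρ δ y - y
      rw [map_neg]
      abel
    · rintro ⟨y, hy⟩
      refine ⟨-y, ?_⟩
      change ρ δ (-y) - (-y) = x
      rw [← hy]; simp; abel
  have hcard : Nat.card (H1 (Rep.of ρ)) = ((ρ δ).charpoly.eval 1).natAbs := by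
    rw [hdet, ← card_quot_range_eq Q _ hinj, ← hker]
    exact (Nat.card_congr (φ.quotKerEquivOfSurjective hφ).toEquiv).symm
  refine ⟨Nat.finite_of_card_ne_zero ?_, hcard⟩
  rw [hcard, hdet]
  simpa using det_ne_zero_of_inj Q _ hinj

/-- Let `G` be a finite cyclic group with generator `δ` acting on a finitely generated
free `ℤ`-module `Q` with `Q^G = 0`. Then `H¹(G, Q)` is a finite group of order `|χ(1)|`,
where `χ` is the characteristic polynomial of the action of `δ` on `Q`. -/
theorem h1_cyclic_card_eq_charpoly_eval_one (G : Type) [Group G] [Fintype G]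
    (δ : G) (hgen : ∀ g : G, g ∈ Subgroup.zpowers δ)
    (Q : Type) [AddCommGroup Q] [Module ℤ Q] [Module.Free ℤ Q] [Module.Finite ℤ Q]
    (ρ : Representation ℤ G Q) (hinv : ρ.invariants = ⊥) :
    Finite (H1 (Rep.of ρ)) ∧
      Nat.card (H1 (Rep.of ρ)) = ((ρ δ).charpoly.eval 1).natAbs := by
  rename_i iG _ _ iM _ _
  obtain rfl : iM = AddCommGroup.toIntModule Q := Subsingleton.elim _ _
  have : IsCyclic G := ⟨δ, hgen⟩
  letI : CommGroup G := IsCyclic.commGroup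
  exact h1_aux G δ hgen Q ρ hinv
end

section
/- Let G = ℤ/pℤ act on a finitely generated free ℤ-module Q with Q^G = 0, generated by δ. Then H¹(G, Q) ≅ (ℤ/pℤ)^s where s = rk(Q)/(p−1). -/
open groupCohomology

open Polynomial in
/-- `p` and `(X-1)^(p-1)` are associated modulo the `p`-th cyclotomic polynomial. -/
lemma poly_identities (p : ℕ) (hp : p.Prime) :
    ∃ g w a : ℤ[X], (X - 1) ^ (p - 1) = (p : ℤ[X]) * g + ∑ i ∈ Finset.range p, X ^ i ∧
      (p : ℤ[X]) = (X - 1) ^ (p - 1) * w + a * ∑ i ∈ Finset.range p, X ^ i := by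
  have : Fact p.Prime := ⟨hp⟩
  set Φ : ℤ[X] := ∑ i ∈ Finset.range p, X ^ i with hΦ
  have h1 : (C (p : ℤ)) ∣ (X - 1) ^ (p - 1) - Φ := by
    rw [C_dvd_iff_dvd_coeff]
    intro i
    have hz : ((X - 1) ^ (p - 1) - Φ).map (Int.castRingHom (ZMod p)) = 0 := by
      have hx : (X - 1 : (ZMod p)[X]) ≠ 0 := by
        simpa using X_sub_C_ne_zero (1 : ZMod p)
      apply mul_left_cancel₀ hx
      have h3 : (X - 1 : (ZMod p)[X]) * ∑ i ∈ Finset.range p, X ^ i = X ^ p - 1 :=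
        mul_geom_sum _ _
      have h4 : (X - 1 : (ZMod p)[X]) * (X - 1) ^ (p - 1) = X ^ p - 1 := by
        rw [mul_pow_sub_one hp.ne_zero, sub_pow_char, one_pow]
      simp only [hΦ, Polynomial.map_sub, Polynomial.map_pow, Polynomial.map_sum, map_X,
        Polynomial.map_one]
      rw [mul_sub, h3, h4]; simp
    have := congrArg (fun q => q.coeff i) hz
    rw [← ZMod.intCast_zmod_eq_zero_iff_dvd]
    simpa only [coeff_map, eq_intCast, coeff_zero] using this
  obtain ⟨g, hg⟩ := h1
  have hpp : p - 1 ≠ 0 := by have := hp.two_le; omega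
  have hg1 : g.eval 1 = -1 := by
    have := congrArg (eval 1) hg
    have hp0 : (p : ℤ) ≠ 0 := by exact_mod_cast hp.ne_zero
    simp [hΦ, eval_finsetSum, hpp] at this
    have : (p : ℤ) * (g.eval 1 + 1) = 0 := by linarith
    rcases mul_eq_zero.1 this with h | h
    · exact absurd h hp0
    · linarith
  obtain ⟨h, hh⟩ : (X - C 1) ∣ g + 1 := by
    rw [dvd_iff_isRoot]; simp [hg1]
  simp only [map_one] at hh
  have hCp : C (p : ℤ) = (p : ℤ[X]) := by simp
  rw [hCp] at hg
  -- g = -(1 - (X-1) h)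
  have hgeom := mul_neg_geom_sum ((X - 1) * h) (p - 1)
  set S := ∑ i ∈ Finset.range (p - 1), ((X - 1) * h) ^ i
  refine ⟨g, p * h ^ (p - 1) - S, S, by linear_combination hg, ?_⟩
  have e : g = (X - 1) * h - 1 := by linear_combination hh
  rw [e] at hg
  rw [mul_pow] at hgeom
  linear_combination S * hg - p * hgeom

open Polynomial in
lemma det_pow {Q : Type} [AddCommGroup Q] [Module.Free ℤ Q] [Module.Finite ℤ Q]
    (p : ℕ) (hp : p.Prime) (T : Module.End ℤ Q) (hT : ∑ i ∈ Finset.range p, T ^ i = 0) :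
    (LinearMap.det (T - 1)).natAbs ^ (p - 1) = p ^ Module.finrank ℤ Q := by
  obtain ⟨g, w, a, h1, h2⟩ := poly_identities p hp
  have h1' := congrArg (aeval T) h1
  have h2' := congrArg (aeval T) h2
  simp only [map_pow, map_sub, map_add, map_mul, map_sum, aeval_X, map_one, map_natCast, hT,
    add_zero, mul_zero] at h1' h2'
  have hdp : LinearMap.det ((p : Module.End ℤ Q)) = (p : ℤ) ^ Module.finrank ℤ Q := by
    have : (p : Module.End ℤ Q) = (p : ℤ) • (1 : Module.End ℤ Q) := by
      ext x; simp
    rw [this, LinearMap.det_smul]; simp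
  have d1 := congrArg LinearMap.det h1'
  have d2 := congrArg LinearMap.det h2'
  rw [map_mul, map_pow, hdp] at d1 d2
  have := Int.natAbs_eq_of_dvd_dvd (Dvd.intro _ d1.symm) (Dvd.intro _ d2.symm)
  rw [Int.natAbs_pow, Int.natAbs_pow, Int.natAbs_natCast] at this
  exact this.symm

lemma vector_space_equiv (K : Type) [Field K] (V : Type) [AddCommGroup V] [Module K V]
    [Finite V] : Nonempty (V ≃+ (Fin (Module.finrank K V) → K)) := by
  have : Module.Finite K V := Module.Finite.of_finite
  exact ⟨(Module.finBasis K V).equivFun.toAddEquiv⟩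

lemma elementary_equiv (p : ℕ) (hp : p.Prime) (V : Type) [AddCommGroup V] [Finite V]
    (h : ∀ x : V, p • x = 0) :
    ∃ r : ℕ, Nat.card V = p ^ r ∧ Nonempty (V ≃+ (Fin r → ZMod p)) := by
  have : Fact p.Prime := ⟨hp⟩
  let _ : Module (ZMod p) V := AddCommGroup.zmodModule h
  exact ⟨Module.finrank (ZMod p) V, (FiniteField.pow_finrank_eq_natCard p V).symm,
    vector_space_equiv (ZMod p) V⟩

lemma quot_equiv {Q : Type} [AddCommGroup Q] [Module.Free ℤ Q] [Module.Finite ℤ Q]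
    (p : ℕ) (hp : p.Prime) (T : Module.End ℤ Q) (hT : ∑ i ∈ Finset.range p, T ^ i = 0)
    (hinj : Function.Injective (T - 1 : Module.End ℤ Q)) :
    Nonempty ((Q ⧸ LinearMap.range (T - 1)) ≃+
      (Fin (Module.finrank ℤ Q / (p - 1)) → ZMod p)) := by
  have : Fact p.Prime := ⟨hp⟩
  have hpp : 0 < p - 1 := by have := hp.two_le; omega
  have hdet := det_pow p hp T hT
  have hcard := Submodule.natAbs_det_equiv (LinearMap.range (T - 1))
    (LinearEquiv.ofInjective (T - 1) hinj)
  have hcomp : (LinearMap.range (T - 1)).subtype ∘ₗ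
      ((LinearEquiv.ofInjective (T - 1) hinj : Q ≃ₗ[ℤ] _) : Q →ₗ[ℤ] _) = T - 1 := by
    ext x; rfl
  have hcard' : (LinearMap.det (T - 1)).natAbs = Nat.card (Q ⧸ LinearMap.range (T - 1)) := by
    rw [← hcard]; congr 2
  rw [hcard'] at hdet
  have hne : Nat.card (Q ⧸ LinearMap.range (T - 1)) ≠ 0 := by
    intro h0
    rw [h0, zero_pow hpp.ne'] at hdet
    exact (pow_ne_zero _ hp.ne_zero) hdet.symm
  have : Finite (Q ⧸ LinearMap.range (T - 1)) := Nat.finite_of_card_ne_zero hne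
  have htors : ∀ x : Q ⧸ LinearMap.range (T - 1), p • x = 0 := by
    intro x
    obtain ⟨y, rfl⟩ := Submodule.Quotient.mk_surjective _ x
    rw [← Submodule.Quotient.mk_smul, Submodule.Quotient.mk_eq_zero]
    have key : ∀ i : ℕ, (T ^ i) y - y ∈ LinearMap.range (T - 1) := by
      intro i
      refine ⟨(∑ j ∈ Finset.range i, T ^ j) y, ?_⟩
      rw [← Module.End.mul_apply, mul_geom_sum]; simp
    have h := Submodule.sum_mem _ (fun i (_ : i ∈ Finset.range p) => key i)
    have h0 := LinearMap.congr_fun hT y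
    rw [LinearMap.sum_apply] at h0
    rw [Finset.sum_sub_distrib, h0] at h
    simpa using h
  obtain ⟨r, hc, he⟩ := elementary_equiv p hp _ htors
  rw [hc, ← pow_mul] at hdet
  have hr := Nat.pow_right_injective hp.two_le hdet
  have : Module.finrank ℤ Q / (p - 1) = r := by
    rw [← hr, Nat.mul_div_cancel _ hpp]
  rw [this]
  exact he

open Rep.FiniteCyclicGroup CategoryTheory in
lemma h1_equiv (k : Type) [CommRing k] (G : Type) [CommGroup G] [Fintype G]
    (δ : G) (hgen : ∀ g : G, g ∈ Subgroup.zpowers δ)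
    (Q : Type) [AddCommGroup Q] [Module k Q] (ρ : Representation k G Q) (hN : ρ.norm = 0) :
    Nonempty ((Q ⧸ LinearMap.range (ρ δ - 1)) ≃+ H1 (Rep.of ρ)) := by
  have hker : ∀ x : Q, x ∈ LinearMap.ker (Rep.of ρ).norm.hom.toLinearMap := by
    intro x
    exact LinearMap.congr_fun hN x
  let π := groupCohomologyπOdd (Rep.of ρ) δ hgen 1 odd_one
  have hepi : Epi π := by
    dsimp only [π, groupCohomologyπOdd]
    refine @epi_comp _ _ _ _ _ _ ?_ _ ?_
    · exact @IsIso.epi_of_iso _ _ _ _ _ (Iso.isIso_inv _)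
    · refine @epi_comp _ _ _ _ _ _ ?_ _ ?_
      · infer_instance
      · exact @IsIso.epi_of_iso _ _ _ _ _ (Iso.isIso_inv _)
  have hs : Function.Surjective π := (ModuleCat.epi_iff_surjective π).1 hepi
  let f : Q →ₗ[k] H1 (Rep.of ρ) :=
    π.hom ∘ₗ (LinearMap.codRestrict (LinearMap.ker (Rep.of ρ).norm.hom.toLinearMap)
      (LinearMap.id : Q →ₗ[k] Q) hker)
  have hf : Function.Surjective f := by
    intro y
    obtain ⟨x, rfl⟩ := hs y
    exact ⟨x.1, rfl⟩
  have hk : LinearMap.range (ρ δ - 1) = LinearMap.ker f := by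
    ext x
    exact (groupCohomologyπOdd_eq_zero_iff (Rep.of ρ) δ hgen 1 odd_one ⟨x, hker x⟩).symm
  exact ⟨((Submodule.quotEquivOfEq _ _ hk).trans (f.quotKerEquivOfSurjective hf)).toAddEquiv⟩

/-- Let `G` be cyclic of prime order `p`, generated by `δ`, acting on a finitely
generated free `ℤ`-module `Q` with `Q^G = 0`. Then `H¹(G, Q) ≅ (ℤ/pℤ)^s` with
`s = rk(Q)/(p-1)`. -/
theorem h1_prime_cyclic_eq_zmod_pow (p : ℕ) (hp : p.Prime)
    (G : Type) [Group G] [Fintype G] (hcard : Fintype.card G = p)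
    (δ : G) (hgen : ∀ g : G, g ∈ Subgroup.zpowers δ)
    (Q : Type) [AddCommGroup Q] [Module ℤ Q] [Module.Free ℤ Q] [Module.Finite ℤ Q]
    (ρ : Representation ℤ G Q) (hinv : ρ.invariants = ⊥) :
    Nonempty (H1 (Rep.of ρ) ≃+ (Fin (Module.finrank ℤ Q / (p - 1)) → ZMod p)) := by
  rename_i iG iF iA iM iFr iFin
  obtain rfl : iM = AddCommGroup.toIntModule Q := Subsingleton.elim _ _
  have hord : orderOf δ = p := by
    rw [orderOf_eq_card_of_forall_mem_zpowers hgen, Nat.card_eq_fintype_card, hcard]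
  have hN : ρ.norm = 0 := by
    ext x
    have : ρ.norm x ∈ ρ.invariants := by
      intro g
      exact LinearMap.congr_fun (ρ.self_comp_norm g) x
    rw [hinv] at this
    simpa using this
  have hT : ∑ i ∈ Finset.range p, (ρ δ) ^ i = 0 := by
    rw [← hN, Representation.norm, ← hord]
    simp_rw [← map_pow]
    classical
    rw [← IsCyclic.image_range_orderOf hgen, Finset.sum_image]
    intro i hi j hj h
    exact pow_injOn_Iio_orderOf (by simpa using hi) (by simpa using hj) h
  have hinj : Function.Injective (ρ δ - 1 : Module.End ℤ Q) := by
    rw [← LinearMap.ker_eq_bot, eq_bot_iff, ← hinv]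
    intro x hx
    rw [Representation.mem_invariants_iff_of_forall_mem_zpowers ρ δ hgen]
    simpa [sub_eq_zero] using hx
  obtain ⟨e⟩ := quot_equiv p hp (ρ δ) hT hinj
  let iC : CommGroup G := { iG with
    mul_comm := fun a b => by
      obtain ⟨m, rfl⟩ := hgen a
      obtain ⟨n, rfl⟩ := hgen b
      exact zpow_mul_comm δ m n }
  obtain ⟨e'⟩ := h1_equiv ℤ G δ hgen Q ρ hN
  exact ⟨e'.symm.trans e⟩
end

section
/- Let p be prime and G = ℤ/pℤ act on a finitely generated free ℤ-module P, with an exact sequence of G-modules 0 → Q → P → ℤ → 0 (trivial action on ℤ) such that Q^G = 0 and the image of P^G in ℤ equals dℤ. Then ℤ/dℤ embeds into a p-torsion group, so d = 1 or d = p, and H¹(G, P) ≅ (ℤ/pℤ)^{s−j} where s = rk(Q)/(p−1) and p^j = d. -/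
open groupCohomology

section Helpers

open Polynomial

lemma aux_poly_dvd (n : ℕ) :
    cyclotomic (n + 1) ℤ ∣ (∏ k ∈ Finset.range n, (1 - X ^ (k + 1) : ℤ[X])) - C ((n : ℤ) + 1) := by
  have hζ : IsPrimitiveRoot (Complex.exp (2 * Real.pi * Complex.I / ((n + 1 : ℕ) : ℂ))) (n + 1) :=
    Complex.isPrimitiveRoot_exp (n + 1) (by omega)
  rw [cyclotomic_eq_minpoly hζ (by omega)]
  refine minpoly.isIntegrallyClosed_dvd (hζ.isIntegral (by omega)) ?_
  have h := hζ.prod_one_sub_pow_eq_order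
  simp only [map_sub, map_prod, map_one, map_pow, aeval_X, h, aeval_C]
  simp

lemma aux_scalar {Q : Type} [AddCommGroup Q] [inst : Module ℤ Q] [Module.Free ℤ Q]
    [Module.Finite ℤ Q] (c : ℤ) :
    LinearMap.det (algebraMap ℤ (Module.End ℤ Q) c) = c ^ Module.finrank ℤ Q := by
  obtain rfl : inst = AddCommGroup.toIntModule Q := Subsingleton.elim _ _
  have h3 := LinearMap.det_smul c (LinearMap.id : Q →ₗ[ℤ] Q)
  rw [LinearMap.det_id, mul_one] at h3
  refine Eq.trans (congrArg _ ?_) h3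
  ext x
  simp

lemma aux_det {Q : Type} [AddCommGroup Q] [Module ℤ Q] [Module.Free ℤ Q] [Module.Finite ℤ Q]
    (p : ℕ) (hp : p.Prime) (T : Module.End ℤ Q) (hT : ∑ k ∈ Finset.range p, T ^ k = 0) :
    (LinearMap.det (1 - T)).natAbs ^ (p - 1) = p ^ Module.finrank ℤ Q := by
  have : Fact p.Prime := ⟨hp⟩
  obtain ⟨n, rfl⟩ : ∃ n, p = n + 1 := ⟨p - 1, by have := hp.pos; omega⟩
  have hTp : T ^ (n + 1) = 1 := by
    have := mul_geom_sum T (n + 1)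
    rw [hT, mul_zero] at this
    exact (sub_eq_zero.1 this.symm)
  have h0 : aeval T (cyclotomic (n + 1) ℤ) = 0 := by
    rw [cyclotomic_prime]
    simpa using hT
  have h1 : aeval T (∏ k ∈ Finset.range n, (1 - X ^ (k + 1) : ℤ[X])) =
      algebraMap ℤ (Module.End ℤ Q) ((n : ℤ) + 1) := by
    obtain ⟨r, hr⟩ := aux_poly_dvd n
    have := congrArg (aeval T) hr
    rw [map_mul, h0, zero_mul, map_sub, aeval_C, sub_eq_zero] at this
    exact this
  let F : ℤ[X] →* ℤ := LinearMap.det.comp ((aeval T : ℤ[X] →ₐ[ℤ] Module.End ℤ Q) : ℤ[X] →* Module.End ℤ Q)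
  have hF : ∀ f, F f = LinearMap.det (aeval T f) := fun f => rfl
  have hX : ∀ m, F (1 - X ^ m) = LinearMap.det (1 - T ^ m) := by
    intro m; rw [hF]; simp
  have hass : ∀ k ∈ Finset.range n,
      (F (1 - X ^ (k + 1))).natAbs = (LinearMap.det (1 - T)).natAbs := by
    intro k hk
    rw [Finset.mem_range] at hk
    rw [Int.natAbs_eq_iff_associated]
    have e1 : LinearMap.det (1 - T) = F (1 - X ^ 1) := by rw [hX, pow_one]
    apply associated_of_dvd_dvd
    · have hc : Nat.Coprime (k + 1) (n + 1) := by
        apply Nat.Coprime.symm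
        rw [hp.coprime_iff_not_dvd]
        intro h
        have := Nat.le_of_dvd (by omega) h
        omega
      obtain ⟨m, hm⟩ := Nat.exists_mul_mod_eq_one_of_coprime hc hp.one_lt
      have : T = T ^ ((k + 1) * m) := by
        rw [← Nat.mod_add_div ((k + 1) * m) (n + 1), hm.2, pow_add, pow_mul, hTp]
        simp
      have e2 : LinearMap.det (1 - T) = F (1 - X ^ ((k + 1) * m)) := by rw [hX, ← this]
      rw [e2]
      apply _root_.map_dvd
      rw [pow_mul]
      simpa using sub_dvd_pow_sub_pow (1 : ℤ[X]) (X ^ (k + 1)) m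
    · rw [e1]
      apply _root_.map_dvd
      simpa using sub_dvd_pow_sub_pow (1 : ℤ[X]) X (k + 1)
  have h2 := congrArg (fun f => (LinearMap.det f).natAbs) h1
  rw [← hF, map_prod] at h2
  rw [← Int.natAbsHom_apply, map_prod] at h2
  simp only [Int.natAbsHom_apply] at h2
  rw [Finset.prod_congr rfl hass, Finset.prod_const, Finset.card_range] at h2
  have h4 := aux_scalar (Q := Q) ((n : ℤ) + 1)
  rw [Nat.add_sub_cancel, h2, h4, Int.natAbs_pow]
  rfl

lemma aux_idx {Q : Type} [AddCommGroup Q] [inst : Module ℤ Q] [Module.Free ℤ Q]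
    [Module.Finite ℤ Q] (f : Q →ₗ[ℤ] Q) (hf : Function.Injective f) :
    (LinearMap.det f).natAbs = Nat.card (Q ⧸ LinearMap.range f) := by
  obtain rfl : inst = AddCommGroup.toIntModule Q := Subsingleton.elim _ _
  exact Submodule.natAbs_det_equiv (LinearMap.range f) (LinearEquiv.ofInjective f hf)

lemma aux_card {Q : Type} [AddCommGroup Q] [Module ℤ Q] [Module.Free ℤ Q] [Module.Finite ℤ Q]
    (p : ℕ) (hp : p.Prime) (T : Module.End ℤ Q) (hT : ∑ k ∈ Finset.range p, T ^ k = 0) :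
    Nat.card (Q ⧸ LinearMap.range (T - 1)) = p ^ (Module.finrank ℤ Q / (p - 1)) := by
  have h := aux_det p hp T hT
  have hp1 : p - 1 ≠ 0 := by have := hp.two_le; omega
  have hne : LinearMap.det (1 - T) ≠ 0 := by
    intro h0
    rw [h0, Int.natAbs_zero, zero_pow hp1] at h
    exact (pow_ne_zero _ hp.ne_zero) h.symm
  have hinj : Function.Injective (1 - T : Module.End ℤ Q) := by
    rw [injective_iff_map_eq_zero]
    intro x hx
    have hTx : T x = x := by
      rw [LinearMap.sub_apply, sub_eq_zero] at hx
      exact hx.symm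
    have hk : ∀ k : ℕ, (T ^ k) x = x := by
      intro k
      induction k with
      | zero => simp
      | succ k ih => rw [pow_succ, Module.End.mul_apply, hTx, ih]
    have h5 := congrArg (fun F : Module.End ℤ Q => F x) hT
    simp only [LinearMap.sum_apply, hk, Finset.sum_const, Finset.card_range,
      LinearMap.zero_apply] at h5
    have : IsAddTorsionFree Q := by
      have := Module.Free.chooseBasis ℤ Q
      exact Function.Injective.isAddTorsionFree this.repr.toAddMonoidHom this.repr.injective
    exact (nsmul_eq_zero_iff_right hp.ne_zero).1 h5
  have hr : LinearMap.range (1 - T : Module.End ℤ Q) = LinearMap.range (T - 1 : Module.End ℤ Q) := by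
    rw [← LinearMap.range_neg, neg_sub]
  rw [← hr, ← aux_idx _ hinj]
  obtain ⟨s, -, hs⟩ := (Nat.dvd_prime_pow hp).1 (h ▸ dvd_pow_self _ hp1)
  rw [hs, ← pow_mul] at h
  rw [hs, ← Nat.pow_right_injective hp.two_le h, Nat.mul_div_cancel _ (Nat.pos_of_ne_zero hp1)]

lemma aux_vs (p m : ℕ) [Fact p.Prime] (A : Type) [AddCommGroup A] [Module (ZMod p) A]
    (hc : Nat.card A = p ^ m) : Nonempty (A ≃+ (Fin m → ZMod p)) := by
  have hp : p.Prime := Fact.out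
  have : Finite A := Nat.finite_of_card_ne_zero (by rw [hc]; exact pow_ne_zero _ hp.ne_zero)
  have h1 := FiniteField.pow_finrank_eq_natCard p A
  rw [hc] at h1
  have h2 : Module.finrank (ZMod p) A = m := Nat.pow_right_injective hp.two_le h1
  have hfin : Module.Finite (ZMod p) A := Module.Finite.of_finite
  exact ⟨(Module.finBasisOfFinrankEq (ZMod p) A h2).equivFun.toAddEquiv⟩

lemma aux_elem (p m : ℕ) (hp : p.Prime) (A : Type) [AddCommGroup A]
    (h : ∀ x : A, p • x = 0) (hc : Nat.card A = p ^ m) : Nonempty (A ≃+ (Fin m → ZMod p)) := by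
  have : Fact p.Prime := ⟨hp⟩
  let : Module (ZMod p) A := AddCommGroup.zmodModule h
  exact aux_vs p m A hc

lemma aux_H1_comm (G : Type) [CommGroup G] [Fintype G]
    (δ : G) (hgen : ∀ x : G, x ∈ Subgroup.zpowers δ)
    (P : Type) [AddCommGroup P] [Module ℤ P] (ρP : Representation ℤ G P) :
    ∃ f : LinearMap.ker ρP.norm →+ H1 (Rep.of ρP), Function.Surjective f ∧
      ∀ x, f x = 0 ↔ ∃ y, ρP δ y - y = x.1 := by
  have hepi : CategoryTheory.Epi (Rep.FiniteCyclicGroup.groupCohomologyπOdd (Rep.of ρP) δ hgen 1 odd_one) := by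
    refine @CategoryTheory.epi_comp _ _ _ _ _ _
      (@CategoryTheory.IsIso.epi_of_iso _ _ _ _ _ (CategoryTheory.Iso.isIso_inv _)) _
      (@CategoryTheory.epi_comp _ _ _ _ _ _ inferInstance _
        (@CategoryTheory.IsIso.epi_of_iso _ _ _ _ _ (CategoryTheory.Iso.isIso_inv _)))
  refine ⟨(Rep.FiniteCyclicGroup.groupCohomologyπOdd (Rep.of ρP) δ hgen 1 odd_one).hom.toAddMonoidHom,
    (ModuleCat.epi_iff_surjective _).1 hepi, fun x => ?_⟩
  exact Rep.FiniteCyclicGroup.groupCohomologyπOdd_eq_zero_iff (Rep.of ρP) δ hgen 1 odd_one x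

lemma aux_H1 (G : Type) [Group G] [Fintype G]
    (δ : G) (hgen : ∀ x : G, x ∈ Subgroup.zpowers δ)
    (P : Type) [AddCommGroup P] [Module ℤ P] (ρP : Representation ℤ G P) :
    ∃ f : LinearMap.ker ρP.norm →+ H1 (Rep.of ρP), Function.Surjective f ∧
      ∀ x, f x = 0 ↔ ∃ y, ρP δ y - y = x.1 := by
  let : CommGroup G := { ‹Group G› with
    mul_comm := fun a b => by
      obtain ⟨m, rfl⟩ := hgen a
      obtain ⟨n, rfl⟩ := hgen b
      exact zpow_mul_comm δ m n }
  exact aux_H1_comm G δ hgen P ρP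

lemma aux_norm (G : Type) [Group G] [Fintype G]
    (δ : G) (hgen : ∀ x : G, x ∈ Subgroup.zpowers δ)
    (Q : Type) [AddCommGroup Q] [Module ℤ Q] (ρ : Representation ℤ G Q) :
    ρ.norm = ∑ k ∈ Finset.range (Fintype.card G), (ρ δ) ^ k := by
  classical
  have ho : orderOf δ = Fintype.card G := by
    rw [orderOf_eq_card_of_forall_mem_zpowers hgen, Nat.card_eq_fintype_card]
  have := IsCyclic.image_range_card hgen
  rw [Representation.norm, ← this, Finset.sum_image, Nat.card_eq_fintype_card]
  · simp
  · intro a ha b hb hab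
    simp only [Finset.coe_range, Set.mem_Iio, Nat.card_eq_fintype_card, ← ho] at ha hb
    exact pow_injOn_Iio_orderOf ha hb hab

end Helpers



/-- Let `p` be prime and `G = ℤ/pℤ` act on a finitely generated free `ℤ`-module `P`,
with an exact sequence of `G`-modules `0 → Q → P → ℤ → 0` (trivial action on `ℤ`) such
that `Q^G = 0` and the image of `P^G` in `ℤ` is `dℤ`.  Then `d = 1` or `d = p`, and
`H¹(G, P) ≅ (ℤ/pℤ)^(s - j)` where `s = rk(Q)/(p-1)` and `p^j = d`. -/
theorem h1_del_pezzo_computation (p : ℕ) (hp : p.Prime)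
    (G : Type) [Group G] [Fintype G] (hcard : Fintype.card G = p)
    (δ : G) (hgen : ∀ x : G, x ∈ Subgroup.zpowers δ)
    (Q P : Type) [AddCommGroup Q] [Module ℤ Q] [Module.Free ℤ Q] [Module.Finite ℤ Q]
    [AddCommGroup P] [Module ℤ P] [Module.Free ℤ P] [Module.Finite ℤ P]
    (ρQ : Representation ℤ G Q) (ρP : Representation ℤ G P)
    (hinv : ρQ.invariants = ⊥)
    (i : Q →ₗ[ℤ] P) (hi : Function.Injective i)
    (hiequiv : ∀ g : G, ∀ x : Q, i (ρQ g x) = ρP g (i x))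
    (φ : P →ₗ[ℤ] ℤ) (hφ : Function.Surjective φ)
    (hφequiv : ∀ g : G, ∀ x : P, φ (ρP g x) = φ x)
    (hexact : LinearMap.range i = LinearMap.ker φ)
    (d : ℕ) (hd : 0 < d)
    (himg : Submodule.map φ ρP.invariants = Submodule.span ℤ {(d : ℤ)}) :
    ∃ j : ℕ, d = p ^ j ∧ (d = 1 ∨ d = p) ∧
      Nonempty (H1 (Rep.of ρP) ≃+
        (Fin (Module.finrank ℤ Q / (p - 1) - j) → ZMod p)) := by

  have hinvmem : ∀ {M : Type} [AddCommGroup M] [Module ℤ M] (ρ : Representation ℤ G M) (x : M),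
      ρ δ x = x → x ∈ ρ.invariants := fun ρ x hx =>
    (Representation.mem_invariants_iff_of_forall_mem_zpowers ρ δ hgen x).2 hx
  -- the norm vanishes on `Q`
  have hNQ : ρQ.norm = 0 := by
    ext x
    have : ρQ.norm x ∈ ρQ.invariants := fun g => ρQ.self_norm_apply g x
    rw [hinv] at this
    simpa using this
  have hsum : ∑ k ∈ Finset.range p, (ρQ δ) ^ k = 0 := by
    rw [← hcard, ← aux_norm G δ hgen Q ρQ, hNQ]
  have hcardQ := aux_card p hp (ρQ δ) hsum
  have hnormi : ∀ q, ρP.norm (i q) = 0 := by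
    intro q
    have : ρP.norm (i q) = i (ρQ.norm q) := by
      simp [Representation.norm, LinearMap.sum_apply, hiequiv]
    rw [this, hNQ]; simp
  have hkerφ : ∀ x, ρP.norm x = 0 → φ x = 0 := by
    intro x hx
    have h1 : φ (ρP.norm x) = p * φ x := by
      simp [Representation.norm, LinearMap.sum_apply, hφequiv, hcard]
    rw [hx, map_zero] at h1
    have : (p : ℤ) ≠ 0 := by exact_mod_cast hp.ne_zero
    exact (mul_eq_zero.1 h1.symm).resolve_left this
  have hφi : ∀ q, φ (i q) = 0 := fun q => by
    have : i q ∈ LinearMap.ker φ := hexact ▸ LinearMap.mem_range_self i q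
    exact this
  have hlift : ∀ x, φ x = 0 → ∃ q, i q = x := fun x hx => by
    have : x ∈ LinearMap.range i := hexact ▸ hx
    exact this
  obtain ⟨f, hfs, hf0⟩ := aux_H1 G δ hgen P ρP
  -- the map `Q → H¹(G, P)`
  let g : Q →+ H1 (Rep.of ρP) := f.comp
    (LinearMap.codRestrict (LinearMap.ker ρP.norm) i (fun q => hnormi q)).toAddMonoidHom
  have hg0 : ∀ q, g q = 0 ↔ ∃ y, ρP δ y - y = i q := fun q => hf0 _
  have hgs : Function.Surjective g := by
    intro z
    obtain ⟨⟨x, hx⟩, rfl⟩ := hfs z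
    obtain ⟨q, rfl⟩ := hlift x (hkerφ x hx)
    exact ⟨q, rfl⟩
  let R : Submodule ℤ Q := LinearMap.range (ρQ δ - 1)
  have hR : ∀ q, q ∈ R ↔ ∃ y, ρQ δ y - y = q := fun q => Iff.rfl
  have hpR : ∀ q, (p : ℕ) • q ∈ R := by
    intro q
    have h1 : ∀ k : ℕ, ((ρQ δ) ^ k) q - q ∈ R := by
      intro k
      refine ⟨(∑ m ∈ Finset.range k, (ρQ δ) ^ m) q, ?_⟩
      have := congrArg (fun F : Module.End ℤ Q => F q) (mul_geom_sum (ρQ δ) k)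
      simpa using this
    have h2 : ∑ k ∈ Finset.range p, (((ρQ δ) ^ k) q - q) ∈ R := R.sum_mem fun k _ => h1 k
    rw [Finset.sum_sub_distrib, ← LinearMap.sum_apply, hsum] at h2
    simpa using h2
  have hgR : R.toAddSubgroup ≤ g.ker := by
    intro q hq
    obtain ⟨y, rfl⟩ := (hR q).1 hq
    exact (hg0 _).2 ⟨i y, by rw [map_sub, hiequiv]⟩
  let gb : (Q ⧸ R.toAddSubgroup) →+ H1 (Rep.of ρP) := QuotientAddGroup.lift R.toAddSubgroup g hgR
  have hgbs : Function.Surjective gb := by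
    intro z
    obtain ⟨q, rfl⟩ := hgs z
    exact ⟨(q : Q ⧸ R.toAddSubgroup), rfl⟩
  -- the generator of the kernel
  obtain ⟨e, he⟩ := hφ 1
  obtain ⟨c, hc⟩ := hlift (ρP δ e - e) (by rw [map_sub, hφequiv, sub_self])
  let cb : Q ⧸ R.toAddSubgroup := (c : Q ⧸ R.toAddSubgroup)
  have hcb : ∀ n : ℕ, n • cb = 0 ↔ d ∣ n := by
    intro n
    have h1 : n • cb = 0 ↔ n • c ∈ R := by
      rw [← Submodule.mem_toAddSubgroup, ← QuotientAddGroup.eq_zero_iff]; rfl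
    rw [h1]
    constructor
    · intro h
      obtain ⟨y, hy⟩ := (hR _).1 h
      have hm : n • e - i y ∈ ρP.invariants := by
        apply hinvmem
        have := congrArg i hy
        rw [map_sub, hiequiv, map_nsmul, hc, nsmul_sub] at this
        rw [map_sub, map_nsmul, sub_eq_sub_iff_sub_eq_sub]
        exact this.symm
      have h3 : φ (n • e - i y) ∈ Submodule.map φ ρP.invariants := ⟨_, hm, rfl⟩
      rw [himg, map_sub, hφi, map_nsmul, he, sub_zero, Submodule.mem_span_singleton] at h3
      obtain ⟨a, ha⟩ := h3
      have : (d : ℤ) ∣ n := ⟨a, by simpa [mul_comm] using ha.symm⟩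
      exact_mod_cast this
    · rintro ⟨a, rfl⟩
      have h3 : (d : ℤ) ∈ Submodule.map φ ρP.invariants := by
        rw [himg]; exact Submodule.mem_span_singleton_self _
      obtain ⟨x, hx, hxd⟩ := h3
      obtain ⟨y, hy⟩ := hlift (d • e - x) (by rw [map_sub, map_nsmul, he, hxd]; simp)
      have hxi : ρP δ x = x := hx δ
      have : d • c ∈ R := by
        rw [hR]
        refine ⟨y, hi ?_⟩
        rw [map_sub, hiequiv, hy, map_nsmul, hc, map_sub, hxi, nsmul_sub, map_nsmul]
        abel
      rw [mul_comm, mul_smul]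
      exact R.toAddSubgroup.nsmul_mem this a
  have hord : addOrderOf cb = d := by
    apply Nat.dvd_antisymm
    · exact addOrderOf_dvd_of_nsmul_eq_zero ((hcb d).2 dvd_rfl)
    · exact (hcb _).1 (addOrderOf_nsmul_eq_zero cb)
  have hker : gb.ker = AddSubgroup.zmultiples cb := by
    apply le_antisymm
    · intro z hz
      obtain ⟨q, rfl⟩ := QuotientAddGroup.mk_surjective z
      obtain ⟨y, hy⟩ := (hg0 q).1 hz
      obtain ⟨q', hq'⟩ := hlift (y - φ y • e) (by rw [map_sub, map_zsmul, he]; simp)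
      refine ⟨φ y, ?_⟩
      have h5 : (φ y • c - q) ∈ R := by
        rw [hR]
        refine ⟨-q', hi ?_⟩
        rw [map_sub, hiequiv, map_neg, map_neg, hq', map_sub, map_sub, ← hy, map_zsmul, map_zsmul,
          hc, zsmul_sub]
        abel
      have h6 : ((φ y • c - q : Q) : Q ⧸ R.toAddSubgroup) = 0 :=
        (QuotientAddGroup.eq_zero_iff _).2 h5
      rw [QuotientAddGroup.mk_sub, sub_eq_zero] at h6
      rw [← h6]
      simp [cb]
    · rw [AddSubgroup.zmultiples_le]
      exact (hg0 c).2 ⟨e, hc.symm⟩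
  have hdp : d ∣ p := by
    rw [← hcb]
    exact (QuotientAddGroup.eq_zero_iff _).2 (hpR c)
  have hcardmul : p ^ (Module.finrank ℤ Q / (p - 1)) = Nat.card (H1 (Rep.of ρP)) * d := by
    have h7 := AddSubgroup.card_eq_card_quotient_mul_card_addSubgroup gb.ker
    rw [Nat.card_congr (QuotientAddGroup.quotientKerEquivOfSurjective gb hgbs).toEquiv, hker,
      Nat.card_zmultiples, hord] at h7
    rw [← h7, ← hcardQ]
    rfl
  have hptors : ∀ z : H1 (Rep.of ρP), p • z = 0 := by
    intro z
    obtain ⟨q, rfl⟩ := hgs z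
    rw [← map_nsmul]
    exact hgR (hpR q)
  obtain ⟨j, -, hj⟩ := (Nat.dvd_prime_pow hp).1 (show d ∣ p ^ 1 by rwa [pow_one])
  refine ⟨j, hj, (Nat.dvd_prime hp).1 hdp, aux_elem p _ hp _ hptors ?_⟩
  have hjs : j ≤ Module.finrank ℤ Q / (p - 1) := by
    rw [← Nat.pow_dvd_pow_iff_le_right hp.one_lt, ← hj]
    exact ⟨_, by rw [hcardmul, mul_comm]⟩
  apply Nat.eq_of_mul_eq_mul_right hd
  rw [← hcardmul, hj, ← pow_add, Nat.sub_add_cancel hjs]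
end
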